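/- Let D^t ⊆ ℝ^n be open and D^z ⊆ ℝ^s be open and symmetric under componentwise sign changes. Let f : D^t → ℝ and cE : D^t × D^z → ℝ^{m₁}, cI : D^t × D^z → ℝ^{m₂}, cZ : D^t × D^z → ℝ^s be twice continuously differentiable, with ∂₂cZ(t,r) strictly lower triangular for all (t,r) ∈ D^t × D^z. Let (t*, z*) ∈ D^t × D^z be feasible (cE(t*,|z*|) = 0, cI(t*,|z*|) ≥ 0, cZ(t*,|z*|) = z*) and kink stationary with multipliers (λ_E, λ_I, λ_Z) that satisfy strict complementarity ((λ_I)ᵢ > 0 for all i ∈ A = {i : cIᵢ(t*,|z*|) = 0}) and strict normal growth (((∂₂cE*)ᵀλ_E − (∂₂cI*)ᵀλ_I + (∂₂cZ*)ᵀλ_Z)ᵢ > |(λ_Z)ᵢ| for all i ∈ α = {i : z*ᵢ = 0}). With σ = sign(z*), Σ = diag(σ), α^c the complement of α, and W = (I − ∂₂cZ*Σ)⁻¹∂₁cZ*, assume LIKQ: J = [[∂₁cE* + ∂₂cE*ΣW], [P_A(∂₁cI* + ∂₂cI*ΣW)], [P_α W]] has full row rank. Assume further that for every nonzero d ∈ ℝ^n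 with Jd = 0, setting d_s = P_{α^c}ᵀP_{α^c}ΣW d, one has (d, d_s)ᵀ H (d, d_s) > 0, where H is the Hessian with respect to (t,r) of (t,r) ↦ f(t) + λ_Eᵀ cE(t,r) − λ_Iᵀ cI(t,r) + λ_Zᵀ cZ(t,r) at (t*, |z*|). Then (t*, z*) is a strict local minimizer of (t,z) ↦ f(t) over F = {(t,z) ∈ D^t × D^z : cE(t,|z|) = 0, cI(t,|z|) ≥ 0, cZ(t,|z|) = z}. -/

import Mathlib

open Matrix
open scoped Classical

noncomputable section

/-- Selection matrix `P_S` whose rows are the unit row vectors `eᵢᵀ`, `i ∈ S`. -/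
def sel {k : ℕ} (p : Fin k → Prop) : Matrix {i // p i} (Fin k) ℝ :=
  Matrix.of fun i j => if (i : Fin k) = j then 1 else 0

/-- componentwise absolute value -/
def vabs {s : ℕ} (z : Fin s → ℝ) : Fin s → ℝ := fun i => |z i|

/-- Partial Jacobian with respect to the first argument. -/
def jac1 {n s m : ℕ} (c : (Fin n → ℝ) × (Fin s → ℝ) → Fin m → ℝ)
    (p : (Fin n → ℝ) × (Fin s → ℝ)) : Matrix (Fin m) (Fin n) ℝ :=
  Matrix.of fun i j => fderiv ℝ c p (Pi.single j 1, 0) i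

/-- Partial Jacobian with respect to the second argument. -/
def jac2 {n s m : ℕ} (c : (Fin n → ℝ) × (Fin s → ℝ) → Fin m → ℝ)
    (p : (Fin n → ℝ) × (Fin s → ℝ)) : Matrix (Fin m) (Fin s) ℝ :=
  Matrix.of fun i j => fderiv ℝ c p (0, Pi.single j 1) i

/-- `W = (I − ∂₂cZ Σ)⁻¹ ∂₁cZ`. -/
def Wmat {n s : ℕ} (cZ : (Fin n → ℝ) × (Fin s → ℝ) → Fin s → ℝ)
    (p : (Fin n → ℝ) × (Fin s → ℝ)) (σ : Fin s → ℝ) : Matrix (Fin s) (Fin n) ℝ :=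
  (1 - jac2 cZ p * Matrix.diagonal σ)⁻¹ * jac1 cZ p

/-- The LIKQ Jacobian `[[∂₁cE + ∂₂cE Σ W], [P_A(∂₁cI + ∂₂cI Σ W)], [P_α W]]`. -/
def likqJ {n s m₁ m₂ : ℕ}
    (cE : (Fin n → ℝ) × (Fin s → ℝ) → Fin m₁ → ℝ)
    (cI : (Fin n → ℝ) × (Fin s → ℝ) → Fin m₂ → ℝ)
    (cZ : (Fin n → ℝ) × (Fin s → ℝ) → Fin s → ℝ)
    (p : (Fin n → ℝ) × (Fin s → ℝ)) (σ : Fin s → ℝ)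
    (Apred : Fin m₂ → Prop) (αpred : Fin s → Prop) :
    Matrix (Fin m₁ ⊕ ({j // Apred j} ⊕ {i // αpred i})) (Fin n) ℝ :=
  Matrix.fromRows
    (jac1 cE p + jac2 cE p * Matrix.diagonal σ * Wmat cZ p σ)
    (Matrix.fromRows
      (sel Apred * (jac1 cI p + jac2 cI p * Matrix.diagonal σ * Wmat cZ p σ))
      (sel αpred * Wmat cZ p σ))

/-- The Lagrangian `(t,r) ↦ f(t) + λ_Eᵀ cE(t,r) − λ_Iᵀ cI(t,r) + λ_Zᵀ cZ(t,r)`. -/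
def Lagr {n s m₁ m₂ : ℕ} (f : (Fin n → ℝ) → ℝ)
    (cE : (Fin n → ℝ) × (Fin s → ℝ) → Fin m₁ → ℝ)
    (cI : (Fin n → ℝ) × (Fin s → ℝ) → Fin m₂ → ℝ)
    (cZ : (Fin n → ℝ) × (Fin s → ℝ) → Fin s → ℝ)
    (lE : Fin m₁ → ℝ) (lI : Fin m₂ → ℝ) (lZ : Fin s → ℝ) :
    (Fin n → ℝ) × (Fin s → ℝ) → ℝ := fun p =>
  f p.1 + lE ⬝ᵥ cE p - lI ⬝ᵥ cI p + lZ ⬝ᵥ cZ p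



open Filter Topology


lemma firstOrder {E G Q : Type*} [NormedAddCommGroup E] [NormedSpace ℝ E]
    [NormedAddCommGroup G] [NormedSpace ℝ G] {c : E → G} {c' : E →L[ℝ] G} {p d : E}
    {F : Filter Q} {δ : Q → E} (h : HasFDerivAt c c' p)
    (h0 : Tendsto δ F (𝓝 0)) (hd : Tendsto (fun q => ‖δ q‖⁻¹ • δ q) F (𝓝 d)) :
    Tendsto (fun q => ‖δ q‖⁻¹ • (c (p + δ q) - c p)) F (𝓝 (c' d)) := by
  have h1 := (hasFDerivAt_iff_isLittleO_nhds_zero.1 h).comp_tendsto h0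
  have h2 : Tendsto (fun q => ‖δ q‖⁻¹ • (c (p + δ q) - c p - c' (δ q))) F (𝓝 0) := by
    have := h1.norm_right.tendsto_inv_smul_nhds_zero
    simpa using this
  have h3 := (c'.continuous.tendsto d).comp hd
  have := h2.add h3
  simp only [zero_add] at this
  refine this.congr fun q => ?_
  simp [smul_sub]

lemma secondOrderO {E : Type*} [NormedAddCommGroup E] [NormedSpace ℝ E]
    {L : E → ℝ} {p : E} (h : ContDiffAt ℝ 2 L p) :
    (fun x : E => L (p + x) - L p - fderiv ℝ L p x - (1/2) * fderiv ℝ (fderiv ℝ L) p x x)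
      =o[𝓝 0] fun x => ‖x‖ ^ 2 := by
  have hsym : IsSymmSndFDerivAt ℝ L p := h.isSymmSndFDerivAt (by simp)
  have hd2 : HasFDerivAt (fderiv ℝ L) (fderiv ℝ (fderiv ℝ L) p) p :=
    ((h.fderiv_right (m := 1) (by norm_num)).differentiableAt (by simp)).hasFDerivAt
  have hev : ∀ᶠ x in 𝓝 p, DifferentiableAt ℝ L x := by
    filter_upwards [h.eventually (by simp)] with x hx using hx.differentiableAt (by simp)
  have hev' : ∀ᶠ x in 𝓝 (0:E), DifferentiableAt ℝ L (p + x) := by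
    have : Tendsto (fun x : E => p + x) (𝓝 0) (𝓝 p) := by
      have : Continuous (fun x : E => p + x) := by fun_prop
      simpa using this.tendsto 0
    exact this.eventually hev
  rw [Asymptotics.isLittleO_iff]
  intro ε hε
  have h1 := (Asymptotics.isLittleO_iff.1 (hasFDerivAt_iff_isLittleO_nhds_zero.1 hd2)) hε
  obtain ⟨r, hr, hball⟩ := Metric.eventually_nhds_iff_ball.1 (h1.and hev')
  filter_upwards [Metric.ball_mem_nhds 0 hr] with x hx
  set φ : E → ℝ := fun x => L (p + x) - L p - fderiv ℝ L p x
    - (1/2) * fderiv ℝ (fderiv ℝ L) p x x with hφ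
  have hder : ∀ y ∈ Metric.closedBall (0:E) ‖x‖, HasFDerivWithinAt φ
      (fderiv ℝ L (p + y) - fderiv ℝ L p - fderiv ℝ (fderiv ℝ L) p y)
      (Metric.closedBall (0:E) ‖x‖) y := by
    intro y hy
    have hy' : y ∈ Metric.ball (0:E) r := by
      simp at hy hx ⊢; linarith
    have a1 : HasFDerivAt (fun y => L (p + y)) (fderiv ℝ L (p + y)) y := by
      have := (hball y hy').2.hasFDerivAt
      have h3 := this.comp y ((hasFDerivAt_id y).const_add p)
      rw [ContinuousLinearMap.comp_id] at h3
      exact h3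
    have a2 : HasFDerivAt (fun y => fderiv ℝ L p y) (fderiv ℝ L p) y :=
      (fderiv ℝ L p).hasFDerivAt
    have a3 := ((fderiv ℝ (fderiv ℝ L) p).hasFDerivAt (x := y)).clm_apply (hasFDerivAt_id y)
    have a4 := (((a1.sub_const (L p)).sub a2).sub (a3.const_mul (1/2))).hasFDerivWithinAt
      (s := Metric.closedBall (0:E) ‖x‖)
    refine a4.congr_fderiv ?_
    ext v
    have := hsym y v
    simp at this ⊢
    linarith
  have hbd : ∀ y ∈ Metric.closedBall (0:E) ‖x‖,
      ‖fderiv ℝ L (p + y) - fderiv ℝ L p - fderiv ℝ (fderiv ℝ L) p y‖ ≤ ε * ‖x‖ := by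
    intro y hy
    have hy' : y ∈ Metric.ball (0:E) r := by
      simp at hy hx ⊢; linarith
    refine (hball y hy').1.trans ?_
    simp at hy
    gcongr
  have := (convex_closedBall (0:E) ‖x‖).norm_image_sub_le_of_norm_hasFDerivWithin_le hder hbd
    (x := 0) (y := x) (by simp) (by simp)
  simp [hφ] at this ⊢
  calc _ ≤ _ := this
    _ = _ := by ring

lemma secondOrder {E Q : Type*} [NormedAddCommGroup E] [NormedSpace ℝ E]
    {L : E → ℝ} {p d : E}
    {F : Filter Q} {δ : Q → E} (h : ContDiffAt ℝ 2 L p)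
    (h0 : Tendsto δ F (𝓝 0)) (hd : Tendsto (fun q => ‖δ q‖⁻¹ • δ q) F (𝓝 d)) :
    Tendsto (fun q => (‖δ q‖ ^ 2)⁻¹ * (L (p + δ q) - L p - fderiv ℝ L p (δ q))) F
      (𝓝 ((1/2) * fderiv ℝ (fderiv ℝ L) p d d)) := by
  have h1 := ((secondOrderO h).comp_tendsto h0).tendsto_inv_smul_nhds_zero
  have h3 : Tendsto (fun q => (1/2) * fderiv ℝ (fderiv ℝ L) p (‖δ q‖⁻¹ • δ q) (‖δ q‖⁻¹ • δ q)) F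
      (𝓝 ((1/2) * fderiv ℝ (fderiv ℝ L) p d d)) := by
    have hc : Continuous (fun x : E => (1/2) * fderiv ℝ (fderiv ℝ L) p x x) := by fun_prop
    exact (hc.tendsto d).comp hd
  have := h1.add h3
  simp only [zero_add] at this
  refine this.congr fun q => ?_
  simp
  ring

lemma jac_split {n s m : ℕ} (c : (Fin n → ℝ) × (Fin s → ℝ) → Fin m → ℝ)
    (p : (Fin n → ℝ) × (Fin s → ℝ)) (u : Fin n → ℝ) (v : Fin s → ℝ) :
    fderiv ℝ c p (u, v) = jac1 c p *ᵥ u + jac2 c p *ᵥ v := by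
  have hu : u = ∑ j, u j • (Pi.single j 1 : Fin n → ℝ) := by
    ext i; simp [Finset.sum_apply, Pi.single_apply]
  have hv : v = ∑ j, v j • (Pi.single j 1 : Fin s → ℝ) := by
    ext i; simp [Finset.sum_apply, Pi.single_apply]
  have h1 : fderiv ℝ c p (u, 0) = jac1 c p *ᵥ u := by
    have : fderiv ℝ c p (u, 0) =
        ((fderiv ℝ c p).comp (ContinuousLinearMap.inl ℝ (Fin n → ℝ) (Fin s → ℝ))) u := by simp
    rw [this]
    conv_lhs => rw [hu]
    rw [map_sum]
    ext i
    simp only [map_smul, Finset.sum_apply, Pi.smul_apply, Matrix.mulVec, dotProduct, jac1,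
      Matrix.of_apply, smul_eq_mul]
    refine Finset.sum_congr rfl fun j _ => ?_
    simp [mul_comm]
  have h2 : fderiv ℝ c p (0, v) = jac2 c p *ᵥ v := by
    have : fderiv ℝ c p (0, v) =
        ((fderiv ℝ c p).comp (ContinuousLinearMap.inr ℝ (Fin n → ℝ) (Fin s → ℝ))) v := by simp
    rw [this]
    conv_lhs => rw [hv]
    rw [map_sum]
    ext i
    simp only [map_smul, Finset.sum_apply, Pi.smul_apply, Matrix.mulVec, dotProduct, jac2,
      Matrix.of_apply, smul_eq_mul]
    refine Finset.sum_congr rfl fun j _ => ?_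
    simp [mul_comm]
  rw [← h1, ← h2, ← map_add]; simp

lemma W_solve {n s : ℕ} (cZ : (Fin n → ℝ) × (Fin s → ℝ) → Fin s → ℝ)
    (p : (Fin n → ℝ) × (Fin s → ℝ)) (σ : Fin s → ℝ)
    (hlow : ∀ i j : Fin s, i ≤ j → jac2 cZ p i j = 0) (u : Fin n → ℝ) (w : Fin s → ℝ)
    (h : w = jac1 cZ p *ᵥ u + jac2 cZ p *ᵥ (Matrix.diagonal σ *ᵥ w)) :
    Wmat cZ p σ *ᵥ u = w := by
  have hdet : (1 - jac2 cZ p * Matrix.diagonal σ).det = 1 := by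
    rw [Matrix.det_of_isLowerTriangular]
    · simp [Matrix.mul_diagonal, hlow]
    · intro i j hij
      have hij' : i < j := by simpa using hij
      simp [Matrix.mul_diagonal, hlow i j hij'.le, hij'.ne]
  have h2 : (1 - jac2 cZ p * Matrix.diagonal σ) *ᵥ w = jac1 cZ p *ᵥ u := by
    rw [Matrix.sub_mulVec, Matrix.one_mulVec, ← Matrix.mulVec_mulVec]
    exact sub_eq_of_eq_add h
  rw [Wmat, ← Matrix.mulVec_mulVec, ← h2, Matrix.mulVec_mulVec, Matrix.nonsing_inv_mul _ (by simp [hdet]),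
    Matrix.one_mulVec]

lemma sel_mulVec {k : ℕ} (P : Fin k → Prop) (w : Fin k → ℝ) (i : {i // P i}) :
    (sel P *ᵥ w) i = w i := by
  simp [sel, Matrix.mulVec, dotProduct]

lemma selT_mulVec {k : ℕ} (P : Fin k → Prop) [Fintype {i // P i}] (w : Fin k → ℝ) (hw : ∀ i, ¬ P i → w i = 0) :
    (sel P)ᵀ *ᵥ (sel P *ᵥ w) = w := by
  ext i
  have : ((sel P)ᵀ *ᵥ (sel P *ᵥ w)) i = ∑ j : {i // P i}, (if (j : Fin k) = i then w j else 0) := by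
    simp only [Matrix.mulVec, dotProduct, Matrix.transpose_apply]
    refine Finset.sum_congr rfl fun j _ => ?_
    have := sel_mulVec P w j
    simp only [Matrix.mulVec, dotProduct] at this
    rw [this]; simp [sel]
  rw [this]
  by_cases h : P i
  · rw [Finset.sum_eq_single (⟨i, h⟩ : {i // P i})]
    · simp
    · intro b _ hb
      rw [if_neg]; intro hh; exact hb (Subtype.ext hh)
    · simp
  · rw [hw i h]
    refine Finset.sum_eq_zero fun j _ => ?_
    rw [if_neg]; intro hh; exact h (hh ▸ j.2)

lemma Lagr_deriv {n s m₁ m₂ : ℕ} {f : (Fin n → ℝ) → ℝ}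
    {cE : (Fin n → ℝ) × (Fin s → ℝ) → Fin m₁ → ℝ}
    {cI : (Fin n → ℝ) × (Fin s → ℝ) → Fin m₂ → ℝ}
    {cZ : (Fin n → ℝ) × (Fin s → ℝ) → Fin s → ℝ}
    (lE : Fin m₁ → ℝ) (lI : Fin m₂ → ℝ) (lZ : Fin s → ℝ)
    {p : (Fin n → ℝ) × (Fin s → ℝ)}
    (hf : DifferentiableAt ℝ f p.1) (hE : DifferentiableAt ℝ cE p)
    (hI : DifferentiableAt ℝ cI p) (hZ : DifferentiableAt ℝ cZ p)
    (hstat : (fun j => fderiv ℝ f p.1 (Pi.single j 1)) +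
      (jac1 cE p)ᵀ *ᵥ lE - (jac1 cI p)ᵀ *ᵥ lI + (jac1 cZ p)ᵀ *ᵥ lZ = 0)
    (u : Fin n → ℝ) (v : Fin s → ℝ) :
    fderiv ℝ (Lagr f cE cI cZ lE lI lZ) p (u, v) =
      ((jac2 cE p)ᵀ *ᵥ lE - (jac2 cI p)ᵀ *ᵥ lI + (jac2 cZ p)ᵀ *ᵥ lZ) ⬝ᵥ v := by
  have key : ∀ {m : ℕ} (l : Fin m → ℝ) (c : (Fin n → ℝ) × (Fin s → ℝ) → Fin m → ℝ),
      DifferentiableAt ℝ c p → ∃ D : (Fin n → ℝ) × (Fin s → ℝ) →L[ℝ] ℝ,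
        HasFDerivAt (fun q => l ⬝ᵥ c q) D p ∧ ∀ x, D x = l ⬝ᵥ fderiv ℝ c p x := by
    intro m l c hc
    refine ⟨∑ i, l i • (ContinuousLinearMap.proj i).comp (fderiv ℝ c p), ?_, ?_⟩
    · have := HasFDerivAt.fun_sum (u := Finset.univ) (fun i _ =>
        ((hasFDerivAt_pi'.1 hc.hasFDerivAt i).const_smul (l i)))
      simpa [dotProduct] using this
    · intro x; simp [dotProduct]
  obtain ⟨DE, hDE, hE'⟩ := key lE cE hE
  obtain ⟨DI, hDI, hI'⟩ := key lI cI hI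
  obtain ⟨DZ, hDZ, hZ'⟩ := key lZ cZ hZ
  have hF : HasFDerivAt (fun q : (Fin n → ℝ) × (Fin s → ℝ) => f q.1)
      ((fderiv ℝ f p.1).comp (ContinuousLinearMap.fst ℝ _ _)) p :=
    hf.hasFDerivAt.comp p hasFDerivAt_fst
  have hL : HasFDerivAt (Lagr f cE cI cZ lE lI lZ) _ p := ((hF.add hDE).sub hDI).add hDZ
  rw [hL.fderiv]
  have hfu : fderiv ℝ f p.1 u = (fun j => fderiv ℝ f p.1 (Pi.single j 1)) ⬝ᵥ u := by
    have hu : u = ∑ j, u j • (Pi.single j 1 : Fin n → ℝ) := by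
      ext i; simp [Finset.sum_apply, Pi.single_apply]
    conv_lhs => rw [hu]
    rw [map_sum]
    simp [dotProduct, mul_comm]
  have hs := congrArg (fun x => x ⬝ᵥ u) hstat
  simp only [add_dotProduct, sub_dotProduct, zero_dotProduct, Matrix.mulVec_transpose,
    ← Matrix.dotProduct_mulVec] at hs ⊢
  simp only [_root_.add_apply, _root_.sub_apply, hE', hI', hZ',
    ContinuousLinearMap.comp_apply, ContinuousLinearMap.coe_fst', jac_split, dotProduct_add, hfu]
  linarith

/-- Second order sufficient conditions for the abs-normal NLP: a kink stationary point
satisfying strict complementarity, strict normal growth, LIKQ and positive definiteness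
of the Lagrangian Hessian on the kernel of the LIKQ Jacobian is a strict local
minimizer. -/
theorem stmt17 {n s m₁ m₂ : ℕ}
    (Dt : Set (Fin n → ℝ)) (Dz : Set (Fin s → ℝ))
    (hDt : IsOpen Dt) (hDz : IsOpen Dz)
    (hsym : ∀ z ∈ Dz, ∀ σ : Fin s → ℝ, (∀ i, σ i = -1 ∨ σ i = 0 ∨ σ i = 1) →
      (fun i => σ i * z i) ∈ Dz)
    (f : (Fin n → ℝ) → ℝ)
    (cE : (Fin n → ℝ) × (Fin s → ℝ) → Fin m₁ → ℝ)
    (cI : (Fin n → ℝ) × (Fin s → ℝ) → Fin m₂ → ℝ)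
    (cZ : (Fin n → ℝ) × (Fin s → ℝ) → Fin s → ℝ)
    (hf : ContDiffOn ℝ 2 f Dt)
    (hcE : ContDiffOn ℝ 2 cE (Dt ×ˢ Dz))
    (hcI : ContDiffOn ℝ 2 cI (Dt ×ˢ Dz))
    (hcZ : ContDiffOn ℝ 2 cZ (Dt ×ˢ Dz))
    (hlow : ∀ p ∈ Dt ×ˢ Dz, ∀ i j : Fin s, i ≤ j → jac2 cZ p i j = 0)
    (tstar : Fin n → ℝ) (zstar : Fin s → ℝ)
    (ht : tstar ∈ Dt) (hz : zstar ∈ Dz)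
    (hfeasE : cE (tstar, vabs zstar) = 0)
    (hfeasI : ∀ j, 0 ≤ cI (tstar, vabs zstar) j)
    (hfeasZ : cZ (tstar, vabs zstar) = zstar)
    (hLIKQ : (likqJ cE cI cZ (tstar, vabs zstar) (fun i => Real.sign (zstar i))
        (fun j => cI (tstar, vabs zstar) j = 0) (fun i => zstar i = 0)).rank
      = m₁ + Fintype.card {j // cI (tstar, vabs zstar) j = 0} +
          Fintype.card {i // zstar i = 0})
    -- kink stationarity multipliers
    (lE : Fin m₁ → ℝ) (lI : Fin m₂ → ℝ) (lZ : Fin s → ℝ)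
    (hstat : (fun j => fderiv ℝ f tstar (Pi.single j 1)) +
      (jac1 cE (tstar, vabs zstar))ᵀ *ᵥ lE -
      (jac1 cI (tstar, vabs zstar))ᵀ *ᵥ lI +
      (jac1 cZ (tstar, vabs zstar))ᵀ *ᵥ lZ = 0)
    -- strict normal growth
    (hgrow : ∀ i, zstar i = 0 →
      |lZ i| < ((jac2 cE (tstar, vabs zstar))ᵀ *ᵥ lE -
        (jac2 cI (tstar, vabs zstar))ᵀ *ᵥ lI +
        (jac2 cZ (tstar, vabs zstar))ᵀ *ᵥ lZ) i)
    (hsig : ∀ i, zstar i ≠ 0 →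
      ((jac2 cE (tstar, vabs zstar))ᵀ *ᵥ lE -
        (jac2 cI (tstar, vabs zstar))ᵀ *ᵥ lI +
        (jac2 cZ (tstar, vabs zstar))ᵀ *ᵥ lZ) i = Real.sign (zstar i) * lZ i)
    (hlI : ∀ j, 0 ≤ lI j)
    (hlIc : lI ⬝ᵥ cI (tstar, vabs zstar) = 0)
    -- strict complementarity
    (hsc : ∀ j, cI (tstar, vabs zstar) j = 0 → 0 < lI j)
    -- positive definiteness on the kernel of the LIKQ Jacobian
    (hpd : ∀ d : Fin n → ℝ, d ≠ 0 →
      likqJ cE cI cZ (tstar, vabs zstar) (fun i => Real.sign (zstar i))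
        (fun j => cI (tstar, vabs zstar) j = 0) (fun i => zstar i = 0) *ᵥ d = 0 →
      0 < fderiv ℝ (fderiv ℝ (Lagr f cE cI cZ lE lI lZ)) (tstar, vabs zstar)
            (d, ((sel fun i => zstar i ≠ 0)ᵀ * ((sel fun i => zstar i ≠ 0) *
              (Matrix.diagonal (fun i => Real.sign (zstar i)) *
                Wmat cZ (tstar, vabs zstar) (fun i => Real.sign (zstar i))))) *ᵥ d)
            (d, ((sel fun i => zstar i ≠ 0)ᵀ * ((sel fun i => zstar i ≠ 0) *
              (Matrix.diagonal (fun i => Real.sign (zstar i)) *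
                Wmat cZ (tstar, vabs zstar) (fun i => Real.sign (zstar i))))) *ᵥ d)) :
    -- strict local minimizer over the abs-normal feasible set
    ∃ Unb ∈ nhds ((tstar, zstar) : (Fin n → ℝ) × (Fin s → ℝ)),
      ∀ q ∈ Unb,
        q ∈ {q : (Fin n → ℝ) × (Fin s → ℝ) |
          q.1 ∈ Dt ∧ q.2 ∈ Dz ∧ cE (q.1, vabs q.2) = 0 ∧
          (∀ j, 0 ≤ cI (q.1, vabs q.2) j) ∧ cZ (q.1, vabs q.2) = q.2} →
        q ≠ (tstar, zstar) → f tstar < f q.1 := by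
  classical
  set p : (Fin n → ℝ) × (Fin s → ℝ) := (tstar, vabs zstar) with hpdef
  set σ : Fin s → ℝ := fun i => Real.sign (zstar i) with hσ
  set g : Fin s → ℝ := (jac2 cE p)ᵀ *ᵥ lE - (jac2 cI p)ᵀ *ᵥ lI + (jac2 cZ p)ᵀ *ᵥ lZ with hg
  have hvz : vabs zstar ∈ Dz := by
    have h1 := hsym zstar hz σ (fun i => Real.sign_apply_eq (zstar i))
    have h2 : vabs zstar = fun i => σ i * zstar i := by
      ext i
      rcases lt_trichotomy (zstar i) 0 with h | h | h
      · simp [vabs, hσ, Real.sign_of_neg h, abs_of_neg h]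
      · simp [vabs, h]
      · simp [vabs, hσ, Real.sign_of_pos h, abs_of_pos h]
    rw [h2]; exact h1
  have hpD : p ∈ Dt ×ˢ Dz := ⟨ht, hvz⟩
  have hnh : Dt ×ˢ Dz ∈ 𝓝 p := (hDt.prod hDz).mem_nhds hpD
  have cdE := hcE.contDiffAt hnh
  have cdI := hcI.contDiffAt hnh
  have cdZ := hcZ.contDiffAt hnh
  have cdf := hf.contDiffAt (hDt.mem_nhds ht)
  have dE := cdE.differentiableAt (by simp)
  have dI := cdI.differentiableAt (by simp)
  have dZ := cdZ.differentiableAt (by simp)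
  have df := cdf.differentiableAt (by simp)
  have cdot : ∀ {m : ℕ} (l : Fin m → ℝ) (c : (Fin n → ℝ) × (Fin s → ℝ) → Fin m → ℝ),
      ContDiffAt ℝ 2 c p → ContDiffAt ℝ 2 (fun q => l ⬝ᵥ c q) p := by
    intro m l c hc
    simp only [dotProduct]
    exact ContDiffAt.sum fun i _ => contDiffAt_const.mul (contDiffAt_pi.1 hc i)
  have cdL : ContDiffAt ℝ 2 (Lagr f cE cI cZ lE lI lZ) p := by
    have h1 : ContDiffAt ℝ 2 (fun q : (Fin n → ℝ) × (Fin s → ℝ) => f q.1) p :=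
      ContDiffAt.comp p (g := f) cdf contDiffAt_fst
    exact ((h1.add (cdot lE cE cdE)).sub (cdot lI cI cdI)).add (cdot lZ cZ cdZ)
  by_contra hcon
  push Not at hcon
  set bad : Set ((Fin n → ℝ) × (Fin s → ℝ)) := {q | (q.1 ∈ Dt ∧ q.2 ∈ Dz ∧ cE (q.1, vabs q.2) = 0 ∧
          (∀ j, 0 ≤ cI (q.1, vabs q.2) j) ∧ cZ (q.1, vabs q.2) = q.2) ∧
          q ≠ (tstar, zstar) ∧ f q.1 ≤ f tstar} with hbad
  have hne : (𝓝 (tstar, zstar) ⊓ 𝓟 bad).NeBot := by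
    rw [inf_principal_neBot_iff]
    intro U hU
    obtain ⟨q, hqU, hq1, hq2, hq3⟩ := hcon U hU
    exact ⟨q, hqU, hq1, hq2, hq3⟩
  set F : Ultrafilter ((Fin n → ℝ) × (Fin s → ℝ)) := Ultrafilter.of (𝓝 (tstar, zstar) ⊓ 𝓟 bad)
  have hF1 : (F : Filter _) ≤ 𝓝 (tstar, zstar) := (Ultrafilter.of_le _).trans inf_le_left
  have hF2 : ∀ᶠ q in (F : Filter _), q ∈ bad :=
    (Ultrafilter.of_le (𝓝 (tstar, zstar) ⊓ 𝓟 bad)).trans inf_le_right (mem_principal_self bad)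
  set δ : (Fin n → ℝ) × (Fin s → ℝ) → (Fin n → ℝ) × (Fin s → ℝ) :=
    fun q => (q.1 - tstar, vabs q.2 - vabs zstar) with hδ
  have hpδ : ∀ q, p + δ q = (q.1, vabs q.2) := by
    intro q; simp [hpdef, hδ]
  have hδc : Continuous δ := by
    have : Continuous (vabs : (Fin s → ℝ) → (Fin s → ℝ)) := by
      unfold vabs; fun_prop
    simp only [hδ]; fun_prop
  have hδ0 : Tendsto δ F (𝓝 0) := by
    have := (hδc.tendsto (tstar, zstar)).mono_left hF1
    have h0 : δ (tstar, zstar) = 0 := by simp [hδ]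
    rwa [h0] at this
  have hz_ev : ∀ i, zstar i ≠ 0 → ∀ᶠ q in (F : Filter ((Fin n → ℝ) × (Fin s → ℝ))),
      q.2 i - zstar i = σ i * (|q.2 i| - |zstar i|) := by
    intro i hi
    have hc : Tendsto (fun q : (Fin n → ℝ) × (Fin s → ℝ) => q.2 i) F (𝓝 (zstar i)) := by
      have : Continuous (fun q : (Fin n → ℝ) × (Fin s → ℝ) => q.2 i) := by fun_prop
      exact (this.tendsto (tstar, zstar)).mono_left hF1
    rcases lt_or_gt_of_ne hi with h | h
    · filter_upwards [hc.eventually_lt_const h] with q hq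
      simp only [hσ, Real.sign_of_neg h, abs_of_neg h, abs_of_neg hq]; ring
    · filter_upwards [hc.eventually_const_lt h] with q hq
      simp only [hσ, Real.sign_of_pos h, abs_of_pos h, abs_of_pos hq]; ring
  have hz_all : ∀ᶠ q in (F : Filter ((Fin n → ℝ) × (Fin s → ℝ))), ∀ i, zstar i ≠ 0 →
      q.2 i - zstar i = σ i * (|q.2 i| - |zstar i|) := by
    rw [eventually_all]; intro i; rw [eventually_imp_distrib_left]; exact hz_ev i
  have hNpos : ∀ᶠ q in (F : Filter _), 0 < ‖δ q‖ := by
    filter_upwards [hF2, hz_all] with q hq hq2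
    rw [norm_pos_iff]
    intro h0
    apply hq.2.1
    have h1 : q.1 = tstar := sub_eq_zero.1 (congrArg Prod.fst h0)
    have h2 : ∀ i, |q.2 i| - |zstar i| = 0 := fun i => congrFun (congrArg Prod.snd h0) i
    refine Prod.ext h1 (funext fun i => ?_)
    by_cases hi : zstar i = 0
    · have := h2 i
      simp only [hi, abs_zero, sub_zero, abs_eq_zero] at this
      simp [this, hi]
    · have := hq2 i hi
      rw [h2 i, mul_zero] at this
      exact sub_eq_zero.1 this
  -- the limiting direction
  obtain ⟨d, hdS, hdlim⟩ : ∃ d ∈ Metric.sphere (0 : (Fin n → ℝ) × (Fin s → ℝ)) 1,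
      Tendsto (fun q => ‖δ q‖⁻¹ • δ q) F (𝓝 d) := by
    have hK := isCompact_sphere (0 : (Fin n → ℝ) × (Fin s → ℝ)) 1
    have := hK.ultrafilter_le_nhds (F.map (fun q => ‖δ q‖⁻¹ • δ q)) (by
      rw [le_principal_iff]
      change ∀ᶠ q in (F : Filter _), ‖δ q‖⁻¹ • δ q ∈ Metric.sphere _ _
      filter_upwards [hNpos] with q hq
      rw [mem_sphere_zero_iff_norm, norm_smul, norm_inv, norm_norm, inv_mul_cancel₀ hq.ne'])
    obtain ⟨d, hd, hle⟩ := this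
    exact ⟨d, hd, hle⟩
  have hN0 : Tendsto (fun q => ‖δ q‖) F (𝓝 0) := by simpa using hδ0.norm
  have limE := firstOrder dE.hasFDerivAt hδ0 hdlim
  have limI := firstOrder dI.hasFDerivAt hδ0 hdlim
  have limZ := firstOrder dZ.hasFDerivAt hδ0 hdlim
  have limL := secondOrder cdL hδ0 hdlim
  set rem : (Fin n → ℝ) × (Fin s → ℝ) → ℝ := fun q =>
    Lagr f cE cI cZ lE lI lZ (p + δ q) - Lagr f cE cI cZ lE lI lZ p
      - fderiv ℝ (Lagr f cE cI cZ lE lI lZ) p (δ q) with hrem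
  set ψ : (Fin n → ℝ) × (Fin s → ℝ) → Fin s → ℝ := fun q i =>
    g i * (|q.2 i| - |zstar i|) - lZ i * (q.2 i - zstar i) with hψ
  set R : (Fin n → ℝ) × (Fin s → ℝ) → ℝ := fun q =>
    (∑ j, lI j * cI (q.1, vabs q.2) j) + ∑ i, ψ q i with hR
  have hid : ∀ q ∈ bad, f q.1 - f tstar = R q + rem q := by
    intro q hq
    obtain ⟨⟨_, _, e1, _, e3⟩, _, _⟩ := hq
    have hD : fderiv ℝ (Lagr f cE cI cZ lE lI lZ) p (δ q) = g ⬝ᵥ (vabs q.2 - vabs zstar) :=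
      Lagr_deriv lE lI lZ df dE dI dZ hstat _ _
    have hs : ∑ i, ψ q i = g ⬝ᵥ (vabs q.2 - vabs zstar) - (lZ ⬝ᵥ q.2 - lZ ⬝ᵥ zstar) := by
      rw [← dotProduct_sub]
      simp only [dotProduct, ← Finset.sum_sub_distrib]
      rfl
    have hi : ∑ j, lI j * cI (q.1, vabs q.2) j = lI ⬝ᵥ cI (q.1, vabs q.2) := rfl
    simp only [hR, hrem]
    rw [hD, hs, hi, hpδ]
    simp only [Lagr]
    rw [e1, e3, hfeasE, hfeasZ, hlIc]
    simp only [dotProduct_zero, hpdef]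
    ring
  have hψlow : ∀ i, zstar i = 0 → ∀ q : (Fin n → ℝ) × (Fin s → ℝ),
      (g i - |lZ i|) * |q.2 i| ≤ ψ q i := by
    intro i hi q
    have : lZ i * q.2 i ≤ |lZ i| * |q.2 i| := by
      rw [← abs_mul]; exact le_abs_self _
    simp only [hψ, hi, abs_zero, sub_zero]
    linarith
  have hψ0 : ∀ᶠ q in (F : Filter _), ∀ i, 0 ≤ ψ q i := by
    filter_upwards [hz_all] with q hq i
    by_cases hi : zstar i = 0
    · refine le_trans ?_ (hψlow i hi q)
      exact mul_nonneg (sub_nonneg.2 (hgrow i hi).le) (abs_nonneg _)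
    · have h1 := hq i hi
      have h2 : g i = σ i * lZ i := hsig i hi
      simp only [hψ]
      rw [h1, h2]
      apply le_of_eq; ring
  have hcI0 : ∀ᶠ q in (F : Filter ((Fin n → ℝ) × (Fin s → ℝ))), ∀ j, 0 ≤ lI j * cI (q.1, vabs q.2) j := by
    filter_upwards [hF2] with q hq j
    exact mul_nonneg (hlI j) (hq.1.2.2.2.1 j)
  have hR0 : ∀ᶠ q in (F : Filter _), 0 ≤ R q := by
    filter_upwards [hψ0, hcI0] with q h1 h2
    exact add_nonneg (Finset.sum_nonneg fun j _ => h2 j) (Finset.sum_nonneg fun j _ => h1 j)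
  have hRrem : ∀ᶠ q in (F : Filter _), R q ≤ - rem q := by
    filter_upwards [hF2] with q hq
    have := hid q hq
    have := hq.2.2
    linarith
  have hH : fderiv ℝ (fderiv ℝ (Lagr f cE cI cZ lE lI lZ)) p d d ≤ 0 := by
    have : (1/2) * fderiv ℝ (fderiv ℝ (Lagr f cE cI cZ lE lI lZ)) p d d ≤ 0 := by
      refine le_of_tendsto limL ?_
      filter_upwards [hR0, hRrem] with q h1 h2
      exact mul_nonpos_of_nonneg_of_nonpos (by positivity) (show rem q ≤ 0 by linarith)
    linarith
  have hRlim : Tendsto (fun q => ‖δ q‖⁻¹ * R q) F (𝓝 0) := by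
    have h1 := (hN0.mul limL).neg
    rw [zero_mul, neg_zero] at h1
    refine tendsto_of_tendsto_of_tendsto_of_le_of_le' tendsto_const_nhds h1 ?_ ?_
    · filter_upwards [hR0] with q h1
      positivity
    · filter_upwards [hRrem, hNpos] with q h1 h2
      calc ‖δ q‖⁻¹ * R q ≤ ‖δ q‖⁻¹ * (- rem q) := by gcongr
        _ = _ := by
          change _ = -(‖δ q‖ * ((‖δ q‖ ^ 2)⁻¹ * rem q))
          field_simp
  -- small quantities
  have hsmall : ∀ (a : ℝ) (h : (Fin n → ℝ) × (Fin s → ℝ) → ℝ), 0 < a →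
      (∀ᶠ q in (F : Filter _), 0 ≤ h q) → (∀ᶠ q in (F : Filter _), a * h q ≤ R q) →
      Tendsto (fun q => ‖δ q‖⁻¹ * h q) F (𝓝 0) := by
    intro a h ha h0 h1
    have h2 := hRlim.const_mul a⁻¹
    rw [mul_zero] at h2
    refine tendsto_of_tendsto_of_tendsto_of_le_of_le' tendsto_const_nhds h2 ?_ ?_
    · filter_upwards [h0] with q h1
      positivity
    · filter_upwards [h1, hNpos] with q h1 h2
      calc ‖δ q‖⁻¹ * h q = a⁻¹ * (‖δ q‖⁻¹ * (a * h q)) := by field_simp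
        _ ≤ _ := by gcongr
  have hIlim : ∀ j, cI p j = 0 → (fderiv ℝ cI p d) j = 0 := by
    intro j hj
    refine tendsto_nhds_unique (((tendsto_pi_nhds.1 limI) j)) ?_
    have := hsmall (lI j) (fun q => cI (q.1, vabs q.2) j) (hsc j hj)
      (by filter_upwards [hF2] with q hq using hq.1.2.2.2.1 j) (by
        filter_upwards [hψ0, hcI0] with q h1 h2
        have h3 : lI j * cI (q.1, vabs q.2) j ≤ ∑ j, lI j * cI (q.1, vabs q.2) j :=
          Finset.single_le_sum (f := fun j => lI j * cI (q.1, vabs q.2) j)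
            (fun j _ => h2 j) (Finset.mem_univ j)
        have h4 : 0 ≤ ∑ i, ψ q i := Finset.sum_nonneg fun i _ => h1 i
        simp only [hR]; linarith)
    refine this.congr fun q => ?_
    rw [hpδ]
    simp [hj]
  have hzlim : ∀ i, zstar i = 0 → Tendsto (fun q => ‖δ q‖⁻¹ * |q.2 i|) F (𝓝 0) := by
    intro i hi
    refine hsmall (g i - |lZ i|) (fun q => |q.2 i|) (sub_pos.2 (hgrow i hi))
      (Eventually.of_forall fun q => abs_nonneg _) ?_
    filter_upwards [hψ0, hcI0] with q h1 h2
    have h3 : ψ q i ≤ ∑ i, ψ q i :=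
      Finset.single_le_sum (f := fun i => ψ q i) (fun j _ => h1 j) (Finset.mem_univ i)
    have h4 : 0 ≤ ∑ j, lI j * cI (q.1, vabs q.2) j := Finset.sum_nonneg fun i _ => h2 i
    have h5 := hψlow i hi q
    simp only [hR]; linarith
  have hElim : fderiv ℝ cE p d = 0 := by
    refine tendsto_nhds_unique limE ?_
    refine tendsto_const_nhds.congr' ?_
    filter_upwards [hF2] with q hq
    rw [hpδ, hq.1.2.2.1, hfeasE]; simp
  have hdr : ∀ i, Tendsto (fun q => ‖δ q‖⁻¹ * (|q.2 i| - |zstar i|)) F (𝓝 (d.2 i)) := by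
    intro i
    have hc : Continuous (fun x : (Fin n → ℝ) × (Fin s → ℝ) => x.2 i) := by fun_prop
    exact (hc.tendsto d).comp hdlim
  set w := fderiv ℝ cZ p d with hw
  have hwlim : ∀ i, Tendsto (fun q => ‖δ q‖⁻¹ * (q.2 i - zstar i)) F (𝓝 (w i)) := by
    intro i
    refine ((tendsto_pi_nhds.1 limZ) i).congr' ?_
    filter_upwards [hF2] with q hq
    rw [hpδ, hq.1.2.2.2.2, hfeasZ]; simp
  have hwα : ∀ i, zstar i = 0 → w i = 0 := by
    intro i hi
    refine tendsto_nhds_unique (hwlim i) ?_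
    refine squeeze_zero_norm (fun q => ?_) (hzlim i hi)
    simp [hi]
  have hdα : ∀ i, zstar i = 0 → d.2 i = 0 := by
    intro i hi
    refine tendsto_nhds_unique (hdr i) ?_
    simpa [hi] using hzlim i hi
  have hσσ : ∀ i, zstar i ≠ 0 → σ i * σ i = 1 := by
    intro i hi
    rcases lt_or_gt_of_ne hi with h | h
    · simp [hσ, Real.sign_of_neg h]
    · simp [hσ, Real.sign_of_pos h]
  have hdσ : Matrix.diagonal σ *ᵥ w = d.2 := by
    ext i
    rw [Matrix.mulVec_diagonal]
    by_cases hi : zstar i = 0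
    · rw [hwα i hi, hdα i hi, mul_zero]
    · have h1 : w i = σ i * d.2 i := by
        refine tendsto_nhds_unique (hwlim i) ?_
        refine ((hdr i).const_mul (σ i)).congr' ?_
        filter_upwards [hz_ev i hi] with q hq
        rw [hq]; ring
      rw [h1, ← mul_assoc, hσσ i hi, one_mul]
  have hWd : Wmat cZ p σ *ᵥ d.1 = w := by
    refine W_solve cZ p σ (hlow p hpD) d.1 w ?_
    rw [hdσ, ← jac_split]
  have hJ : likqJ cE cI cZ p σ (fun j => cI p j = 0) (fun i => zstar i = 0) *ᵥ d.1 = 0 := by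
    have hgen : ∀ {m : ℕ} (c : (Fin n → ℝ) × (Fin s → ℝ) → Fin m → ℝ),
        (jac1 c p + jac2 c p * Matrix.diagonal σ * Wmat cZ p σ) *ᵥ d.1 = fderiv ℝ c p d := by
      intro m c
      rw [Matrix.add_mulVec, ← Matrix.mulVec_mulVec, ← Matrix.mulVec_mulVec, hWd, hdσ,
        ← jac_split]
    rw [likqJ, Matrix.fromRows_mulVec, Matrix.fromRows_mulVec, hgen, ← Matrix.mulVec_mulVec,
      ← Matrix.mulVec_mulVec, hgen, hWd, hElim]
    ext k
    rcases k with k | k | k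
    · rfl
    · exact (sel_mulVec _ _ k).trans (hIlim k k.2)
    · exact (sel_mulVec _ _ k).trans (hwα k k.2)
  have hd1 : d.1 ≠ 0 := by
    intro h0
    have hw0 : w = 0 := by rw [← hWd, h0, Matrix.mulVec_zero]
    have hd2 : d.2 = 0 := by rw [← hdσ, hw0, Matrix.mulVec_zero]
    have : d = 0 := Prod.ext h0 hd2
    rw [this] at hdS
    simp at hdS
  have hfin := hpd d.1 hd1 hJ
  have hds : ((sel fun i => zstar i ≠ 0)ᵀ * ((sel fun i => zstar i ≠ 0) *
      (Matrix.diagonal σ * Wmat cZ p σ))) *ᵥ d.1 = d.2 := by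
    rw [← Matrix.mulVec_mulVec, ← Matrix.mulVec_mulVec, ← Matrix.mulVec_mulVec, hWd, hdσ]
    exact selT_mulVec (fun i => zstar i ≠ 0) _ fun i hi => hdα i (not_not.1 hi)
  rw [hds] at hfin
  exact absurd hfin (not_lt.2 hH)

end
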